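/- For every integer s ≥ 1, the (2s-1)-th derivative of z ↦ cot(πz) at z = 1/4 equals -2^(2s)·(2^(2s)-1)·(2s-1)!·ζ(2s)/π, which is a rational multiple of π^(2s-1). -/

import Mathlib

open Real

lemma analyticOnNhd_pi_mul_cot_pi_mul :
    AnalyticOnNhd ℂ (fun z : ℂ => π * Complex.cot (π * z)) Complex.integerComplement := by
  refine DifferentiableOn.analyticOnNhd (fun z hz => DifferentiableAt.differentiableWithinAt ?_)
    Complex.isOpen_compl_range_intCast
  simp_rw [Complex.cot_eq_cos_div_sin]
  have hs : Complex.sin (π * z) ≠ 0 := sin_pi_mul_ne_zero hz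
  fun_prop (disch := assumption)

lemma iteratedDeriv_re_ofReal_eq {F : ℂ → ℂ} {U : Set ℂ} (hU : IsOpen U)
    (hF : AnalyticOnNhd ℂ F U) (n : ℕ) :
    ∀ x : ℝ, (x : ℂ) ∈ U →
      iteratedDeriv n (fun t : ℝ => (F t).re) x = (iteratedDeriv n F x).re := by
  induction n with
  | zero => simp
  | succ n ih =>
    intro x hx
    have hd : DifferentiableAt ℂ (iteratedDeriv n F) x := by
      rw [iteratedDeriv_eq_iterate]
      exact (hF.iterated_deriv n x hx).differentiableAt
    have hev : iteratedDeriv n (fun t : ℝ => (F t).re) =ᶠ[nhds x]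
        fun t : ℝ => (iteratedDeriv n F t).re := by
      filter_upwards [(hU.preimage Complex.continuous_ofReal).mem_nhds hx] with t ht
      exact ih t ht
    rw [iteratedDeriv_succ, iteratedDeriv_succ, hev.deriv_eq]
    exact hd.hasDerivAt.real_of_complex.deriv

lemma summable_one_div_norm_ofReal_add_int_pow (a : ℝ) {k : ℕ} (hk : 1 < k) :
    Summable fun n : ℤ => 1 / ‖(a : ℂ) + n‖ ^ k := by
  have h := (Real.summable_one_div_int_add_rpow a k).mpr (by exact_mod_cast hk)
  refine h.congr fun n => ?_
  rw [Real.rpow_natCast, add_comm (a : ℂ), ← Complex.ofReal_intCast, ← Complex.ofReal_add,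
    Complex.norm_real, Real.norm_eq_abs]

open Filter Topology in
/-- The series expansion of the iterated derivative of `π cot (π z)` at a real non-integer. -/
lemma iteratedDeriv_pi_mul_cot_pi_mul_ofReal {k : ℕ} (hk : 1 ≤ k) {x : ℝ}
    (hx : (x : ℂ) ∈ Complex.integerComplement) :
    iteratedDeriv k (fun z : ℂ => π * Complex.cot (π * z)) x =
      (-1) ^ k * k.factorial * ∑' n : ℤ, 1 / ((x : ℂ) + n) ^ (k + 1) := by
  have hpath : Tendsto (fun ε : ℝ => (x : ℂ) + ε * Complex.I) (𝓝[>] 0) (𝓝 x) := by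
    have : Continuous fun ε : ℝ => (x : ℂ) + ε * Complex.I := by fun_prop
    simpa using (this.tendsto 0).mono_left nhdsWithin_le_nhds
  have hne : ∀ n : ℤ, (x : ℂ) + n ≠ 0 := fun n h =>
    hx ⟨-n, by push_cast; linear_combination -h⟩
  have hcont : ContinuousAt (iteratedDeriv k fun z : ℂ => π * Complex.cot (π * z)) x := by
    rw [iteratedDeriv_eq_iterate]
    exact (analyticOnNhd_pi_mul_cot_pi_mul.iterated_deriv k x hx).continuousAt
  have hsum : Tendsto (fun ε : ℝ => ∑' n : ℤ, 1 / ((x : ℂ) + ε * Complex.I + n) ^ (k + 1))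
      (𝓝[>] 0) (𝓝 (∑' n : ℤ, 1 / ((x : ℂ) + n) ^ (k + 1))) := by
    refine tendsto_tsum_of_dominated_convergence
      (summable_one_div_norm_ofReal_add_int_pow x (k := k + 1) (by omega)) (fun n => ?_)
      (Eventually.of_forall fun ε n => ?_)
    · exact tendsto_const_nhds.div ((hpath.add_const _).pow _) (pow_ne_zero _ (hne n))
    · rw [norm_div, norm_one, norm_pow]
      have hpos : 0 < ‖(x : ℂ) + n‖ := norm_pos_iff.mpr (hne n)
      gcongr 1 / ?_ ^ _
      have h1 : (x : ℂ) + n = ((((x : ℂ) + ε * Complex.I + n).re : ℝ) : ℂ) := by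
        simp
      rw [h1, Complex.norm_real]
      exact Complex.abs_re_le_norm _
  refine tendsto_nhds_unique (hcont.tendsto.comp hpath)
    ((hsum.const_mul ((-1) ^ k * (k.factorial : ℂ))).congr' ?_)
  filter_upwards [self_mem_nhdsWithin] with ε hε
  have hz : (x : ℂ) + ε * Complex.I ∈ UpperHalfPlane.upperHalfPlaneSet := by
    simpa [UpperHalfPlane.upperHalfPlaneSet] using hε
  rw [Function.comp_apply, ← iteratedDerivWithin_of_isOpen
    UpperHalfPlane.isOpen_upperHalfPlaneSet hz,
    iteratedDerivWithin_cot_pi_mul_eq_mul_tsum_div_pow hk hz]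

lemma tsum_one_div_quarter_add_int_pow {k : ℕ} (hk : 1 < k) (hk2 : Even k) :
    ∑' n : ℤ, 1 / ((1 / 4 : ℂ) + n) ^ k = 2 ^ k * (2 ^ k - 1) * riemannZeta k := by
  have hz : Summable fun n : ℕ => 1 / (n : ℂ) ^ k := by
    refine Summable.of_norm ?_
    simpa using Real.summable_nat_pow_inv.mpr hk
  have hinj : Function.Injective fun n : ℕ => 2 * n := fun a b h => by simpa using h
  have hinj' : Function.Injective fun n : ℕ => 2 * n + 1 := fun a b h => by simpa using h
  set f : ℕ → ℂ := fun n => 1 / ((2 * n + 1 : ℕ) : ℂ) ^ k with hf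
  have hfs : Summable f := hz.comp_injective hinj'
  have hes : Summable fun n : ℕ => 1 / ((2 * n : ℕ) : ℂ) ^ k := hz.comp_injective hinj
  have hzeta : (2 ^ k)⁻¹ * riemannZeta k + ∑' n, f n = riemannZeta k := by
    conv_rhs => rw [zeta_nat_eq_tsum_of_gt_one hk,
      ← tsum_even_add_odd (f := fun n : ℕ => 1 / (n : ℂ) ^ k) hes hfs]
    congr 1
    rw [zeta_nat_eq_tsum_of_gt_one hk, ← tsum_mul_left]
    refine tsum_congr fun n => ?_
    push_cast
    rw [mul_pow]
    simp [mul_comm]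
  have hse : Summable fun n : ℕ => f (2 * n) := hfs.comp_injective hinj
  have hso : Summable fun n : ℕ => f (2 * n + 1) := hfs.comp_injective hinj'
  have he : ∀ n : ℕ, 1 / ((1 / 4 : ℂ) + ((n : ℤ) : ℂ)) ^ k = 4 ^ k * f (2 * n) := by
    intro n
    have h : (1 / 4 : ℂ) + ((n : ℤ) : ℂ) = ((2 * (2 * n) + 1 : ℕ) : ℂ) / 4 := by
      push_cast; ring
    rw [h, div_pow, hf]
    simp only [one_div, inv_div]
    rw [div_eq_mul_inv]
  have ho : ∀ n : ℕ, 1 / ((1 / 4 : ℂ) + ((-(n + 1) : ℤ) : ℂ)) ^ k = 4 ^ k * f (2 * n + 1) := by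
    intro n
    have h : (1 / 4 : ℂ) + ((-(n + 1) : ℤ) : ℂ) = -(((2 * (2 * n + 1) + 1 : ℕ) : ℂ) / 4) := by
      push_cast; ring
    rw [h, hk2.neg_pow, div_pow, hf]
    simp only [one_div, inv_div]
    rw [div_eq_mul_inv]
  rw [tsum_of_nat_of_neg_add_one (by simpa only [he] using hse.mul_left (4 ^ k))
    (by simpa only [ho] using hso.mul_left (4 ^ k)), tsum_congr he, tsum_congr ho,
    tsum_mul_left, tsum_mul_left, ← mul_add, tsum_even_add_odd (f := f) hse hso]
  have h4 : (4 : ℂ) ^ k = 2 ^ k * 2 ^ k := by rw [← mul_pow]; norm_num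
  have h2 : (2 : ℂ) ^ k ≠ 0 := pow_ne_zero k two_ne_zero
  have hfz : ∑' n, f n = riemannZeta k - (2 ^ k)⁻¹ * riemannZeta k := by
    linear_combination hzeta
  rw [hfz, h4]
  field_simp

lemma quarter_mem_integerComplement : ((1 / 4 : ℝ) : ℂ) ∈ Complex.integerComplement := by
  rintro ⟨n, hn⟩
  have h : (4 * n : ℝ) = 1 := by
    have : (n : ℝ) = 1 / 4 := by exact_mod_cast hn
    linarith
  have : 4 * n = 1 := by exact_mod_cast h
  omega

theorem iteratedDeriv_cot_quarter_eq (s : ℕ) (hs : 1 ≤ s) :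
    ((iteratedDeriv (2 * s - 1) (fun z : ℝ => Real.cot (π * z)) (1/4) : ℝ) : ℂ) =
      -2 ^ (2 * s) * (2 ^ (2 * s) - 1) * (Nat.factorial (2 * s - 1)) *
        riemannZeta (2 * s) / (π : ℂ) ∧
    ∃ q : ℚ, iteratedDeriv (2 * s - 1) (fun z : ℝ => Real.cot (π * z)) (1/4) =
      q * π ^ (2 * s - 1) := by
  have hpi : (π : ℂ) ≠ 0 := Complex.ofReal_ne_zero.mpr Real.pi_ne_zero
  set r : ℚ := -2 ^ (2 * s) * (2 ^ (2 * s) - 1) * (Nat.factorial (2 * s - 1)) *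
    ((-1) ^ (s + 1) * 2 ^ (2 * s - 1) * bernoulli (2 * s) / (2 * s).factorial) with hr
  have hval : (-2 ^ (2 * s) * (2 ^ (2 * s) - 1) * (Nat.factorial (2 * s - 1)) *
      riemannZeta (2 * s) : ℂ) = ((r * π ^ (2 * s) : ℝ) : ℂ) := by
    rw [riemannZeta_two_mul_nat (by omega), hr]
    push_cast
    ring
  have hcomplex := iteratedDeriv_pi_mul_cot_pi_mul_ofReal (k := 2 * s - 1) (by omega)
    quarter_mem_integerComplement
  have hodd : Odd (2 * s - 1) := ⟨s - 1, by omega⟩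
  have hcast : ((1 / 4 : ℝ) : ℂ) = 1 / 4 := by norm_num
  rw [show 2 * s - 1 + 1 = 2 * s by omega, hodd.neg_one_pow] at hcomplex
  conv_rhs at hcomplex =>
    rw [hcast, tsum_one_div_quarter_add_int_pow (by omega) (even_two_mul s)]
  have hcomplex' : iteratedDeriv (2 * s - 1) (fun z : ℂ => π * Complex.cot (π * z))
      ((1 / 4 : ℝ) : ℂ) = ((r * π ^ (2 * s) : ℝ) : ℂ) := by
    rw [hcomplex, ← hval]
    push_cast
    ring
  have hreal : π * iteratedDeriv (2 * s - 1) (fun z : ℝ => Real.cot (π * z)) (1 / 4) =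
      r * π ^ (2 * s) := by
    have h := iteratedDeriv_re_ofReal_eq Complex.isOpen_compl_range_intCast
      analyticOnNhd_pi_mul_cot_pi_mul (2 * s - 1) (1 / 4) quarter_mem_integerComplement
    rw [hcomplex', Complex.ofReal_re] at h
    rw [← h, ← iteratedDeriv_const_mul_field]
    congr 1
    ext t
    rw [← Complex.ofReal_mul, ← Complex.ofReal_cot, ← Complex.ofReal_mul, Complex.ofReal_re]
  constructor
  · rw [hval, ← hreal, Complex.ofReal_mul, mul_div_cancel_left₀ _ hpi]
  · refine ⟨r, mul_left_cancel₀ Real.pi_ne_zero ?_⟩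
    rw [hreal]
    obtain ⟨m, hm⟩ : ∃ m, 2 * s = m + 1 := ⟨2 * s - 1, by omega⟩
    rw [hm, Nat.add_sub_cancel]
    ring
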